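/- Let 2 ≤ m ≤ n. For every g ∈ Sp(n,1), the set { trace(g·(I_{n−m} ⊕ ι(A))·g⁻¹) : A ∈ SU(m,1) } is not contained in ℝ, where I_{n−m} ⊕ ι(A) denotes the (n+1)×(n+1) block diagonal matrix whose upper-left block is the identity of size n−m and whose lower-right block is the entrywise image ι(A) of A in M_{m+1}(ℍ). -/

import Mathlib

open Matrix BigOperators

noncomputable section

abbrev Hq : Type := Quaternion ℝ

def qi : Hq := ⟨0, 1, 0, 0⟩
def qj : Hq := ⟨0, 0, 1, 0⟩
def qk : Hq := ⟨0, 0, 0, 1⟩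

/-- A quaternion is real if all its imaginary parts vanish. -/
def isRealQ (q : Hq) : Prop := q.imI = 0 ∧ q.imJ = 0 ∧ q.imK = 0

/-- The matrix `J_{n,1}` with diagonal `(1,…,1,−1)`. -/
def Jq (n : ℕ) : Matrix (Fin (n+1)) (Fin (n+1)) Hq :=
  Matrix.diagonal fun i => if i = Fin.last n then -1 else 1

/-- `Sp(n,1)` as a set of `(n+1)×(n+1)` quaternionic matrices. -/
def Sp (n : ℕ) : Set (Matrix (Fin (n+1)) (Fin (n+1)) Hq) :=
  {g | gᴴ * Jq n * g = Jq n}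

/-- The complex matrix `J_{m,1}`. -/
def Jc (m : ℕ) : Matrix (Fin (m+1)) (Fin (m+1)) ℂ :=
  Matrix.diagonal fun i => if i = Fin.last m then -1 else 1

/-- `SU(m,1)` as a set of `(m+1)×(m+1)` complex matrices. -/
def SU (m : ℕ) : Set (Matrix (Fin (m+1)) (Fin (m+1)) ℂ) :=
  {A | Aᴴ * Jc m * A = Jc m ∧ A.det = 1}

/-- The ℝ-algebra embedding `ℂ → ℍ`, `a + b√(−1) ↦ a + b i`. -/
def ι (z : ℂ) : Hq := ⟨z.re, z.im, 0, 0⟩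


/-- Block diagonal sum of square matrices. -/
def oplus {R : Type*} [Zero R] {p q : ℕ} (A : Matrix (Fin p) (Fin p) R)
    (B : Matrix (Fin q) (Fin q) R) : Matrix (Fin (p + q)) (Fin (p + q)) R :=
  Matrix.reindex finSumFinEquiv finSumFinEquiv (Matrix.fromBlocks A 0 0 B)

/-- Reindexing a square matrix along an equality of sizes. -/
def castM {R : Type*} {p q : ℕ} (h : p = q) (A : Matrix (Fin p) (Fin p) R) :
    Matrix (Fin q) (Fin q) R :=
  Matrix.reindex (finCongr h) (finCongr h) A

/-- The diagonal entries of `J_{n,1}` as real numbers. -/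
def signJ (n : ℕ) (i : Fin (n + 1)) : ℝ := if i = Fin.last n then -1 else 1

/-- The imaginary quaternion by which the `j`-th diagonal coordinate contributes to the imaginary
part of the trace of a conjugate of a complex diagonal matrix by `g ∈ Sp(n,1)`. -/
def colForm {n : ℕ} (g : Matrix (Fin (n + 1)) (Fin (n + 1)) Hq) (j : Fin (n + 1)) : Hq :=
  ∑ i, (signJ n i * signJ n j) • (g i j * qi * star (g i j))

lemma signJ_mul_self (n : ℕ) (i : Fin (n + 1)) : signJ n i * signJ n i = 1 := by
  unfold signJ; split_ifs <;> norm_num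

lemma Jq_eq (n : ℕ) : Jq n = Matrix.diagonal fun i => ((signJ n i : ℝ) : Hq) := by
  unfold Jq signJ
  congr 1
  funext i
  split_ifs <;> simp

lemma Jq_mul_self (n : ℕ) : Jq n * Jq n = 1 := by
  rw [Jq_eq, Matrix.diagonal_mul_diagonal, ← Matrix.diagonal_one]
  congr 1
  funext i
  rw [← Quaternion.coe_mul, signJ_mul_self, Quaternion.coe_one]

lemma inverse_of_mem_Sp {n : ℕ} {g : Matrix (Fin (n + 1)) (Fin (n + 1)) Hq} (hg : g ∈ Sp n) :
    Ring.inverse g = Jq n * gᴴ * Jq n := by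
  have h : Jq n * gᴴ * Jq n * g = 1 := by
    have hg' : gᴴ * Jq n * g = Jq n := hg
    calc Jq n * gᴴ * Jq n * g = Jq n * (gᴴ * Jq n * g) := by simp only [Matrix.mul_assoc]
      _ = 1 := by rw [hg', Jq_mul_self]
  exact Ring.inverse_unit ⟨g, Jq n * gᴴ * Jq n, mul_eq_one_comm.mp h, h⟩

lemma coe_sum_real {α : Type*} [Fintype α] (f : α → ℝ) :
    ((∑ i, f i : ℝ) : Hq) = ∑ i, (f i : Hq) := by
  have h := map_sum (algebraMap ℝ Hq) f Finset.univ
  exact h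

lemma ι_eq (z : ℂ) : ι z = (z.re : Hq) + z.im • qi := by
  apply Quaternion.ext
  · change z.re = z.re + z.im * 0
    ring
  · change z.im = 0 + z.im * 1
    ring
  · change 0 = 0 + z.im * 0
    ring
  · change 0 = 0 + z.im * 0
    ring

lemma mul_ι_mul_star (q : Hq) (z : ℂ) :
    q * ι z * star q =
      ((z.re * Quaternion.normSq q : ℝ) : Hq) + z.im • (q * qi * star q) := by
  rw [ι_eq, mul_add, add_mul, ← Quaternion.coe_commutes, mul_assoc, Quaternion.self_mul_star,
    Quaternion.coe_mul, mul_smul_comm, smul_mul_assoc]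

lemma re_mul_qi_mul_star (q : Hq) : (q * qi * star q).re = 0 := by
  have h0 : qi.re = 0 := rfl
  have h1 : qi.imI = 1 := rfl
  have h2 : qi.imJ = 0 := rfl
  have h3 : qi.imK = 0 := rfl
  simp only [Quaternion.re_mul, Quaternion.imI_mul, Quaternion.imJ_mul, Quaternion.imK_mul,
    Quaternion.re_star, Quaternion.imI_star, Quaternion.imJ_star, Quaternion.imK_star,
    h0, h1, h2, h3]
  ring

lemma re_sum_smul_eq_zero {α : Type*} [Fintype α] (a : α → ℝ) (f : α → Hq)
    (hf : ∀ i, (f i).re = 0) : (∑ i, a i • f i).re = 0 := by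
  refine Finset.sum_induction _ (fun q : Hq => q.re = 0) (fun p q hp hq => ?_) rfl
    fun i _ => ?_
  · rw [Quaternion.re_add, hp, hq, add_zero]
  · rw [Quaternion.re_smul, hf, smul_zero]

lemma re_colForm {n : ℕ} (g : Matrix (Fin (n + 1)) (Fin (n + 1)) Hq) (j : Fin (n + 1)) :
    (colForm g j).re = 0 :=
  re_sum_smul_eq_zero _ _ fun _ => re_mul_qi_mul_star _

lemma trace_conj_diagonal {n : ℕ} {g : Matrix (Fin (n + 1)) (Fin (n + 1)) Hq} (hg : g ∈ Sp n)
    (c : Fin (n + 1) → ℂ) :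
    ∃ r : ℝ, (g * Matrix.diagonal (fun j => ι (c j)) * Ring.inverse g).trace =
      (r : Hq) + ∑ j, (c j).im • colForm g j := by
  refine ⟨∑ j, ∑ i, signJ n i * signJ n j * ((c j).re * Quaternion.normSq (g i j)), ?_⟩
  have key (i j : Fin (n + 1)) :
      (g * Matrix.diagonal (fun j => ι (c j))) i j * (Jq n * gᴴ * Jq n) j i =
        ((signJ n i * signJ n j * ((c j).re * Quaternion.normSq (g i j)) : ℝ) : Hq) +
          (c j).im • ((signJ n i * signJ n j) • (g i j * qi * star (g i j))) := by
    rw [Jq_eq, Matrix.mul_diagonal, Matrix.mul_diagonal, Matrix.diagonal_mul,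
      Matrix.conjTranspose_apply]
    calc g i j * ι (c j) * ((signJ n j : Hq) * star (g i j) * (signJ n i : Hq))
        = (signJ n i * signJ n j) • (g i j * ι (c j) * star (g i j)) := by
          rw [← Quaternion.coe_commutes (signJ n i), Quaternion.coe_mul_eq_smul,
            Quaternion.coe_mul_eq_smul, mul_smul_comm, mul_smul_comm, smul_smul]
      _ = _ := by
          rw [mul_ι_mul_star, smul_add, smul_comm (signJ n i * signJ n j) (c j).im,
            Quaternion.smul_coe]
  rw [inverse_of_mem_Sp hg]
  simp only [Matrix.trace, Matrix.diag]
  simp_rw [Matrix.mul_apply (M := g * Matrix.diagonal fun j => ι (c j)), key]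
  rw [Finset.sum_comm]
  simp only [Finset.sum_add_distrib, colForm, Finset.smul_sum]
  congr 1
  rw [coe_sum_real]
  exact Finset.sum_congr rfl fun j _ => (coe_sum_real _).symm

lemma sum_eq_zero_of_isRealQ {n : ℕ} {g : Matrix (Fin (n + 1)) (Fin (n + 1)) Hq} (hg : g ∈ Sp n)
    (c : Fin (n + 1) → ℂ)
    (h : isRealQ (g * Matrix.diagonal (fun j => ι (c j)) * Ring.inverse g).trace) :
    ∑ j, (c j).im • colForm g j = 0 := by
  obtain ⟨r, hr⟩ := trace_conj_diagonal hg c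
  have hre : (∑ j, (c j).im • colForm g j).re = 0 :=
    re_sum_smul_eq_zero _ _ (re_colForm g)
  rw [hr] at h
  obtain ⟨h1, h2, h3⟩ := h
  rw [Quaternion.imI_add, Quaternion.imI_coe, zero_add] at h1
  rw [Quaternion.imJ_add, Quaternion.imJ_coe, zero_add] at h2
  rw [Quaternion.imK_add, Quaternion.imK_coe, zero_add] at h3
  exact Quaternion.ext _ _ hre h1 h2 h3

lemma norm_mul_qi_mul_star (q : Hq) : ‖q * qi * star q‖ = Quaternion.normSq q := by
  have hqi : ‖qi‖ = 1 := by
    have h : Quaternion.normSq qi = 1 := by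
      rw [Quaternion.normSq_def']
      change (0 : ℝ) ^ 2 + 1 ^ 2 + 0 ^ 2 + 0 ^ 2 = 1
      norm_num
    rw [Quaternion.normSq_eq_norm_mul_self] at h
    nlinarith [norm_nonneg qi]
  rw [norm_mul, norm_mul, hqi, Quaternion.norm_star, mul_one, Quaternion.normSq_eq_norm_mul_self]

lemma sum_normSq_last {n : ℕ} {g : Matrix (Fin (n + 1)) (Fin (n + 1)) Hq} (hg : g ∈ Sp n) :
    ∑ i, signJ n i * Quaternion.normSq (g i (Fin.last n)) = -1 := by
  have h : (gᴴ * Jq n * g) (Fin.last n) (Fin.last n) = Jq n (Fin.last n) (Fin.last n) :=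
    congrFun (congrFun hg _) _
  rw [Jq_eq, Matrix.mul_apply, Matrix.diagonal_apply_eq] at h
  have h' : ((∑ i, signJ n i * Quaternion.normSq (g i (Fin.last n)) : ℝ) : Hq) =
      ((-1 : ℝ) : Hq) := by
    calc ((∑ i, signJ n i * Quaternion.normSq (g i (Fin.last n)) : ℝ) : Hq)
        = ∑ i, ((signJ n i * Quaternion.normSq (g i (Fin.last n)) : ℝ) : Hq) :=
          coe_sum_real _
      _ = _ := by
          rw [show (-1 : ℝ) = signJ n (Fin.last n) by simp [signJ], ← h]
          refine Finset.sum_congr rfl fun i _ => ?_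
          rw [Matrix.mul_diagonal, Matrix.conjTranspose_apply, ← Quaternion.coe_commutes,
            mul_assoc, Quaternion.star_mul_self, Quaternion.coe_mul]
  exact Quaternion.coe_injective h'

lemma colForm_last_ne_zero {n : ℕ} {g : Matrix (Fin (n + 1)) (Fin (n + 1)) Hq} (hg : g ∈ Sp n) :
    colForm g (Fin.last n) ≠ 0 := by
  intro h
  have h1 := sum_normSq_last hg
  rw [Fin.sum_univ_castSucc] at h1
  rw [colForm, Fin.sum_univ_castSucc] at h
  simp only [signJ, Fin.castSucc_ne_last, if_false, if_true, one_mul, neg_smul, one_smul,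
    Finset.sum_neg_distrib, neg_mul, mul_neg, neg_neg] at h h1
  rw [neg_add_eq_zero] at h
  have h2 := norm_sum_le Finset.univ fun i : Fin n =>
    g i.castSucc (Fin.last n) * qi * star (g i.castSucc (Fin.last n))
  rw [h] at h2
  simp only [norm_mul_qi_mul_star] at h2
  linarith

/-- The diagonal entries `(w, w, 1, …, 1, w̄²)`. -/
def torusEntry (m : ℕ) (w : ℂ) (j : Fin (m + 1)) : ℂ :=
  if j = Fin.last m then star w ^ 2 else if j = 0 ∨ j = 1 then w else 1

lemma sum_torusEntry_im {m : ℕ} (hm : 2 ≤ m) (w : ℂ) {V : Type*} [AddCommGroup V] [Module ℝ V]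
    (v : Fin (m + 1) → V) :
    ∑ j, (torusEntry m w j).im • v j =
      w.im • (v 0 + v 1) + (star w ^ 2).im • v (Fin.last m) := by
  obtain ⟨k, rfl⟩ := Nat.exists_eq_add_of_le' hm
  have hne (i : Fin k) : (i : ℕ) ≠ k := i.isLt.ne
  rw [Fin.sum_univ_castSucc, Fin.sum_univ_succ, Fin.sum_univ_succ]
  simp [torusEntry, hne, Fin.ext_iff, smul_add, add_assoc]

lemma prod_torusEntry {m : ℕ} (hm : 2 ≤ m) {w : ℂ} (hw : star w * w = 1) :
    ∏ j, torusEntry m w j = 1 := by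
  obtain ⟨k, rfl⟩ := Nat.exists_eq_add_of_le' hm
  have hne (i : Fin k) : (i : ℕ) ≠ k := i.isLt.ne
  rw [Fin.prod_univ_castSucc, Fin.prod_univ_succ, Fin.prod_univ_succ]
  simp [torusEntry, hne, Fin.ext_iff]
  simp at hw
  linear_combination (starRingEnd ℂ w * w + 1) * hw

lemma diagonal_torusEntry_mem_SU {m : ℕ} (hm : 2 ≤ m) {w : ℂ} (hw : star w * w = 1) :
    Matrix.diagonal (torusEntry m w) ∈ SU m := by
  refine ⟨?_, by rw [Matrix.det_diagonal, prod_torusEntry hm hw]⟩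
  rw [Jc, Matrix.diagonal_conjTranspose, Matrix.diagonal_mul_diagonal,
    Matrix.diagonal_mul_diagonal]
  congr 1
  funext j
  have h : star (torusEntry m w j) * torusEntry m w j = 1 := by
    unfold torusEntry
    split_ifs
    · rw [star_pow, star_star, ← mul_pow, mul_comm, hw, one_pow]
    · exact hw
    · simp
  rw [Pi.star_apply, mul_right_comm, h, one_mul]

lemma castM_oplus_diagonal {n m p : ℕ} (h : p + (m + 1) = n + 1) (d : Fin (m + 1) → ℂ) :
    castM h (oplus (1 : Matrix (Fin p) (Fin p) Hq) ((Matrix.diagonal d).map ι)) =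
      Matrix.diagonal fun j => ι
        (Sum.elim (fun _ => 1) d (finSumFinEquiv.symm ((finCongr h).symm j))) := by
  have h0 : ι 0 = 0 := rfl
  have h1 : ι 1 = 1 := rfl
  rw [castM, oplus, Matrix.diagonal_map h0, ← Matrix.diagonal_one, Matrix.fromBlocks_diagonal]
  simp only [Matrix.reindex_apply, Matrix.submatrix_diagonal_equiv]
  congr 1
  funext j
  simp only [Function.comp_apply]
  rcases finSumFinEquiv.symm ((finCongr h).symm j) with a | a <;> simp [h1]

lemma sum_block_im {n m p : ℕ} (h : p + (m + 1) = n + 1) (d : Fin (m + 1) → ℂ)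
    {V : Type*} [AddCommGroup V] [Module ℝ V] (v : Fin (n + 1) → V) :
    ∑ j, (Sum.elim (fun _ => 1) d (finSumFinEquiv.symm ((finCongr h).symm j)) : ℂ).im • v j =
      ∑ j, (d j).im • v (finCongr h (Fin.natAdd p j)) := by
  rw [← Equiv.sum_comp (finSumFinEquiv.trans (finCongr h)), Fintype.sum_sum_type]
  simp

/-- for `2 ≤ m ≤ n` and every `g ∈ Sp(n,1)`, the set of traces of
`g·(I_{n−m} ⊕ ι(SU(m,1)))·g⁻¹` is not contained in `ℝ`. -/
theorem stmt12 (n m : ℕ) (hm : 2 ≤ m) (hmn : m ≤ n)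
    (g : Matrix (Fin (n+1)) (Fin (n+1)) Hq) (hg : g ∈ Sp n) :
    ∃ A ∈ SU m,
      ¬ isRealQ ((g * castM (by omega : (n - m) + (m + 1) = n + 1)
          (oplus (1 : Matrix (Fin (n - m)) (Fin (n - m)) Hq) (A.map ι))
          * Ring.inverse g).trace) := by
  by_contra! hA
  have h : (n - m) + (m + 1) = n + 1 := by omega
  have key (w : ℂ) (hw : star w * w = 1) :
      w.im • (colForm g (finCongr h (Fin.natAdd (n - m) 0)) +
          colForm g (finCongr h (Fin.natAdd (n - m) 1))) +
        (star w ^ 2).im • colForm g (Fin.last n) = 0 := by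
    have hw' := hA _ (diagonal_torusEntry_mem_SU hm hw)
    rw [castM_oplus_diagonal] at hw'
    have hsum := sum_eq_zero_of_isRealQ hg _ hw'
    rw [sum_block_im h, sum_torusEntry_im hm w
      (fun j => colForm g (finCongr h (Fin.natAdd (n - m) j)))] at hsum
    have hlast : finCongr h (Fin.natAdd (n - m) (Fin.last m)) = Fin.last n := by
      ext; simp; omega
    rwa [hlast] at hsum
  have hI := key Complex.I (by simp)
  have hw := key ⟨3 / 5, 4 / 5⟩ (by apply Complex.ext <;> simp <;> norm_num)
  have hv : colForm g (finCongr h (Fin.natAdd (n - m) 0)) +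
      colForm g (finCongr h (Fin.natAdd (n - m) 1)) = 0 := by
    simpa [sq] using hI
  rw [hv, smul_zero, zero_add] at hw
  refine (smul_eq_zero.mp hw).elim (fun h0 => ?_) (colForm_last_ne_zero hg)
  simp [sq] at h0
  norm_num at h0
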